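/- Let G=(V,E) be a finite simple graph with m = |E| edges in which every vertex has degree at least 1, and suppose there exists S ⊆ V with e_G(S, V∖S) ≥ (1−ε)m for some 0 < ε < 1/2. Then for every integer t ≥ 0 there exists a subset V_g ⊆ V with μ_G(V_g) ≥ μ_G/8 such that every v ∈ V_g satisfies Σ_{u∈V} |(1_v M^t)(u)| ≥ (1/60)·(1−2ε)^t, and consequently ‖(1_v M^t) D^{−1/2}‖_2² ≥ (1/(3600·μ_G))·(1−2ε)^{2t}. -/

import Mathlib

open scoped Classical
open Matrix

noncomputable section

namespace Sublinear

variable {V : Type*}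

/-- The degree `d(v)` of a vertex, as a real number. -/
def deg [Fintype V] (G : SimpleGraph V) (v : V) : ℝ :=
  ((Finset.univ.filter fun u => G.Adj v u).card : ℝ)

/-- The volume `μ_G(S)` of a set of vertices. -/
def vol [Fintype V] (G : SimpleGraph V) (S : Set V) : ℝ :=
  ∑ v ∈ Finset.univ.filter (fun v => v ∈ S), deg G v

/-- The number of ordered adjacent pairs `(u,v)` with `u ∈ S`, `v ∈ T`.
For disjoint `S`, `T` this equals the number `e_G(S,T)` of edges between `S` and `T`. -/
def eB [Fintype V] (G : SimpleGraph V) (S T : Set V) : ℝ :=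
  (((Finset.univ : Finset (V × V)).filter
      fun p => p.1 ∈ S ∧ p.2 ∈ T ∧ G.Adj p.1 p.2).card : ℝ)

/-- The number `e_G(S)` of edges with both endpoints in `S`. -/
def eIn [Fintype V] (G : SimpleGraph V) (S : Set V) : ℝ := eB G S S / 2

/-- The conductance `φ_G(S)` of a set of vertices. -/
def cond [Fintype V] (G : SimpleGraph V) (S : Set V) : ℝ :=
  eB G S Sᶜ / vol G S

/-- The conductance `φ_G` of the graph: the minimum of `φ_G(S)` over nonempty `S`
with `μ_G(S) ≤ μ_G/2`. -/
def conductance [Fintype V] (G : SimpleGraph V) : ℝ :=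
  sInf {x | ∃ S : Set V, S.Nonempty ∧ vol G S ≤ vol G Set.univ / 2 ∧ x = cond G S}

/-- The adjacency matrix `A` of `G`, with real entries. -/
def adjMat [Fintype V] (G : SimpleGraph V) : Matrix V V ℝ :=
  Matrix.of fun u v => if G.Adj u v then (1 : ℝ) else 0

/-- The diagonal matrix `D⁻¹` of inverse degrees. -/
def degInv [Fintype V] [DecidableEq V] (G : SimpleGraph V) : Matrix V V ℝ :=
  Matrix.diagonal fun v => (deg G v)⁻¹

/-- The diagonal matrix `D^{-1/2}` of inverse square roots of degrees. -/
def degInvSqrt [Fintype V] [DecidableEq V] (G : SimpleGraph V) : Matrix V V ℝ :=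
  Matrix.diagonal fun v => (Real.sqrt (deg G v))⁻¹

/-- The normalized Laplacian `𝓛 = I - D^{-1/2} A D^{-1/2}` of `G`. -/
def normLap [Fintype V] [DecidableEq V] (G : SimpleGraph V) : Matrix V V ℝ :=
  1 - degInvSqrt G * adjMat G * degInvSqrt G

/-- The lazy random walk matrix `W = (I + D⁻¹ A)/2` of `G`. -/
def lazyW [Fintype V] [DecidableEq V] (G : SimpleGraph V) : Matrix V V ℝ :=
  ((1 : ℝ) / 2) • (1 + degInv G * adjMat G)

/-- The matrix `M = I - W = (I - D⁻¹ A)/2`. -/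
def walkM [Fintype V] [DecidableEq V] (G : SimpleGraph V) : Matrix V V ℝ :=
  ((1 : ℝ) / 2) • (1 - degInv G * adjMat G)

/-- The indicator row vector `1_v` of a vertex `v`. -/
def indVec (v : V) : V → ℝ := fun u => if u = v then 1 else 0

/-- `t` is an eigenvalue of the matrix `M`. -/
def IsEigenvalue [Fintype V] (M : Matrix V V ℝ) (t : ℝ) : Prop :=
  ∃ x : V → ℝ, x ≠ 0 ∧ M *ᵥ x = t • x

/-- A lower bound for `⟨y, Nᵗ y⟩` when `y` is close to a vector `x` whose Rayleigh quotient with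
respect to the symmetric contraction `0 ≤ N ≤ 1` is at least `1 - ε`. -/
theorem le_dotProduct_pow_mulVec {V : Type*} [Fintype V] [DecidableEq V] {N : Matrix V V ℝ}
    (hN : N.IsHermitian) (h0 : ∀ x, 0 ≤ x ⬝ᵥ N *ᵥ x) (h1 : ∀ x, x ⬝ᵥ N *ᵥ x ≤ x ⬝ᵥ x)
    {ε : ℝ} (hε0 : 0 < ε) (hε1 : ε < 1 / 2) {x y : V → ℝ}
    (hx : (1 - ε) * (x ⬝ᵥ x) ≤ x ⬝ᵥ N *ᵥ x)
    (hxy : (x - y) ⬝ᵥ (x - y) ≤ (x ⬝ᵥ x) / 8) (t : ℕ) :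
    (1 - 2 * ε) ^ t * ((x ⬝ᵥ x) / 8) ≤ y ⬝ᵥ (N ^ t) *ᵥ y := by
  set B : V → V → ℝ := fun i => ⇑(hN.eigenvectorBasis i) with hB
  set l := hN.eigenvalues with hl
  have parseval : ∀ z w : V → ℝ, z ⬝ᵥ w = ∑ i, (B i ⬝ᵥ z) * (B i ⬝ᵥ w) := by
    intro z w
    have h := hN.eigenvectorBasis.sum_inner_mul_inner (WithLp.toLp 2 z) (WithLp.toLp 2 w)
    simp only [EuclideanSpace.inner_eq_star_dotProduct, star_trivial] at h
    rw [dotProduct_comm z w, ← h]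
    refine Finset.sum_congr rfl fun i _ => ?_
    rw [dotProduct_comm w]
  have eig : ∀ i (k : ℕ), (N ^ k) *ᵥ B i = (l i) ^ k • B i := by
    intro i k
    induction k with
    | zero => simp
    | succ k ih =>
      rw [pow_succ, ← mulVec_mulVec, hB]
      simp only
      rw [hN.mulVec_eigenvectorBasis i, mulVec_smul]
      change l i • ((N ^ k) *ᵥ B i) = _
      rw [ih, smul_smul, pow_succ, mul_comm]
  have coef : ∀ i (k : ℕ) z, B i ⬝ᵥ (N ^ k) *ᵥ z = (l i) ^ k * (B i ⬝ᵥ z) := by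
    intro i k z
    have hT : (N ^ k)ᵀ = N ^ k := by
      rw [transpose_pow]
      congr 1
    rw [dotProduct_mulVec, ← mulVec_transpose, hT, eig, smul_dotProduct, smul_eq_mul]
  have quad : ∀ (k : ℕ) z, z ⬝ᵥ (N ^ k) *ᵥ z = ∑ i, (l i) ^ k * (B i ⬝ᵥ z) ^ 2 := by
    intro k z
    rw [parseval]
    refine Finset.sum_congr rfl fun i _ => ?_
    rw [coef]
    ring
  have norm_sq : ∀ z, z ⬝ᵥ z = ∑ i, (B i ⬝ᵥ z) ^ 2 := by
    intro z
    rw [parseval]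
    exact Finset.sum_congr rfl fun i _ => (sq _).symm
  have norm_eig : ∀ i, B i ⬝ᵥ B i = 1 := by
    intro i
    have h := hN.eigenvectorBasis.inner_eq_ite i i
    rw [EuclideanSpace.inner_eq_star_dotProduct] at h
    simpa using h
  have rayleigh : ∀ i, B i ⬝ᵥ N *ᵥ B i = l i := by
    intro i
    have h := coef i 1 (B i)
    rwa [pow_one, pow_one, norm_eig, mul_one] at h
  have l0 : ∀ i, 0 ≤ l i := fun i => rayleigh i ▸ h0 (B i)
  have l1 : ∀ i, l i ≤ 1 := fun i => by
    have h := h1 (B i)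
    rwa [rayleigh, norm_eig] at h
  have hxN : x ⬝ᵥ N *ᵥ x = ∑ i, l i * (B i ⬝ᵥ x) ^ 2 := by
    simpa using quad 1 x
  rw [hxN] at hx
  rw [norm_sq x] at hx hxy ⊢
  rw [norm_sq (x - y)] at hxy
  rw [quad]
  set c := 1 - 2 * ε with hc
  have hc0 : 0 ≤ c := by linarith
  have key : ∀ i, (B i ⬝ᵥ x) ^ 2 * (l i - c) / (2 * (2 * ε)) * c ^ t
      ≤ (l i ^ t * (B i ⬝ᵥ y) ^ 2) + (B i ⬝ᵥ (x - y)) ^ 2 * c ^ t := by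
    intro i
    have hct : 0 ≤ c ^ t := pow_nonneg hc0 t
    rw [dotProduct_sub]
    generalize B i ⬝ᵥ x = a
    generalize B i ⬝ᵥ y = b
    rcases le_or_gt c (l i) with h | h
    · have hp : c ^ t ≤ l i ^ t := pow_le_pow_left₀ hc0 h t
      have e1 : a ^ 2 * (l i - c) / (2 * (2 * ε)) ≤ a ^ 2 / 2 := by
        rw [div_le_div_iff₀ (by positivity) (by positivity)]
        nlinarith [sq_nonneg a, l1 i, mul_le_mul_of_nonneg_left (l1 i) (sq_nonneg a)]
      have e2 : a ^ 2 / 2 ≤ b ^ 2 + (a - b) ^ 2 := by nlinarith [sq_nonneg (a - 2 * b)]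
      calc _ ≤ (b ^ 2 + (a - b) ^ 2) * c ^ t := by gcongr; exact e1.trans e2
        _ = c ^ t * b ^ 2 + (a - b) ^ 2 * c ^ t := by ring
        _ ≤ _ := by gcongr
    · have e1 : a ^ 2 * (l i - c) / (2 * (2 * ε)) * c ^ t ≤ 0 := by
        refine mul_nonpos_of_nonpos_of_nonneg (div_nonpos_of_nonpos_of_nonneg ?_ (by positivity)) hct
        exact mul_nonpos_of_nonneg_of_nonpos (sq_nonneg a) (by linarith)
      have e2 : 0 ≤ l i ^ t * b ^ 2 := mul_nonneg (pow_nonneg (l0 i) t) (sq_nonneg b)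
      have e3 : 0 ≤ (a - b) ^ 2 * c ^ t := by positivity
      linarith
  have hsum := Finset.sum_le_sum fun i (_ : i ∈ Finset.univ) => key i
  rw [Finset.sum_add_distrib, ← Finset.sum_mul, ← Finset.sum_mul, ← Finset.sum_div] at hsum
  have e1 : ∑ i, (B i ⬝ᵥ x) ^ 2 * (l i - c)
      = ∑ i, l i * (B i ⬝ᵥ x) ^ 2 - c * ∑ i, (B i ⬝ᵥ x) ^ 2 := by
    rw [Finset.mul_sum, ← Finset.sum_sub_distrib]
    exact Finset.sum_congr rfl fun i _ => by ring
  have e2 : (∑ i, (B i ⬝ᵥ x) ^ 2) / 4 ≤ (∑ i, (B i ⬝ᵥ x) ^ 2 * (l i - c)) / (2 * (2 * ε)) := by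
    rw [e1, div_le_div_iff₀ (by norm_num) (by positivity)]
    nlinarith
  have hct : 0 ≤ c ^ t := pow_nonneg hc0 t
  have e3 := mul_le_mul_of_nonneg_right e2 hct
  have e4 := mul_le_mul_of_nonneg_right hxy hct
  linarith

theorem deg_eq_sum_adjMat {V : Type*} [Fintype V] (G : SimpleGraph V) (v : V) :
    deg G v = ∑ u, adjMat G v u := by
  simp [deg, adjMat]

theorem adjMat_symm {V : Type*} [Fintype V] (G : SimpleGraph V) (u v : V) :
    adjMat G u v = adjMat G v u := by
  simp [adjMat, G.adj_comm]

theorem eB_eq_sum {V : Type*} [Fintype V] (G : SimpleGraph V) (S T : Set V) :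
    eB G S T = ∑ u, ∑ v, adjMat G u v * if u ∈ S ∧ v ∈ T then 1 else 0 := by
  rw [← Fintype.sum_prod_type', eB, Finset.card_filter]
  push_cast
  refine Finset.sum_congr rfl fun p _ => ?_
  by_cases h1 : p.1 ∈ S <;> by_cases h2 : p.2 ∈ T <;> simp [adjMat, h1, h2]

theorem eB_comm {V : Type*} [Fintype V] (G : SimpleGraph V) (S T : Set V) :
    eB G S T = eB G T S := by
  rw [eB_eq_sum, eB_eq_sum, Finset.sum_comm]
  refine Finset.sum_congr rfl fun u _ => Finset.sum_congr rfl fun v _ => ?_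
  rw [adjMat_symm]
  congr 1
  exact if_congr and_comm rfl rfl

theorem eB_univ_univ {V : Type*} [Fintype V] (G : SimpleGraph V) :
    eB G Set.univ Set.univ = vol G Set.univ := by
  simp [eB_eq_sum, vol, deg_eq_sum_adjMat]

theorem walkM_mulVec_apply {V : Type*} [Fintype V] [DecidableEq V] (G : SimpleGraph V)
    (h : V → ℝ) (v : V) :
    (walkM G *ᵥ h) v = (h v - (deg G v)⁻¹ * ∑ u, adjMat G v u * h u) / 2 := by
  simp only [walkM, degInv, smul_mulVec, sub_mulVec, one_mulVec, ← mulVec_mulVec, Pi.smul_apply,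
    Pi.sub_apply, mulVec_diagonal, smul_eq_mul]
  simp only [mulVec, dotProduct]
  ring

theorem sum_deg_mul_sq {V : Type*} [Fintype V] (G : SimpleGraph V) (h : V → ℝ) :
    ∑ v, deg G v * h v ^ 2 = (∑ u, ∑ v, adjMat G u v * (h u ^ 2 + h v ^ 2)) / 2 := by
  have e : ∑ u, ∑ v, adjMat G u v * h v ^ 2 = ∑ u, ∑ v, adjMat G u v * h u ^ 2 := by
    rw [Finset.sum_comm]
    simp only [adjMat_symm G]
  simp only [mul_add, Finset.sum_add_distrib, e, deg_eq_sum_adjMat, Finset.sum_mul]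
  ring

theorem sum_deg_mul_walkM {V : Type*} [Fintype V] [DecidableEq V] (G : SimpleGraph V)
    (hdeg : ∀ v, 1 ≤ deg G v) (h : V → ℝ) :
    ∑ v, deg G v * h v * (walkM G *ᵥ h) v
      = (∑ u, ∑ v, adjMat G u v * (h u - h v) ^ 2) / 4 := by
  have e : ∀ v, deg G v * h v * (walkM G *ᵥ h) v
      = (deg G v * h v ^ 2) / 2 - (∑ u, adjMat G v u * (h v * h u)) / 2 := by
    intro v
    have hd : deg G v ≠ 0 := by linarith [hdeg v]
    have e2 : ∑ u, adjMat G v u * (h v * h u) = h v * ∑ u, adjMat G v u * h u := by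
      rw [Finset.mul_sum]
      exact Finset.sum_congr rfl fun u _ => by ring
    rw [walkM_mulVec_apply, e2]
    field_simp
  have e3 : ∑ u, ∑ v, adjMat G u v * (h u - h v) ^ 2
      = ∑ u, ∑ v, adjMat G u v * (h u ^ 2 + h v ^ 2)
        - 2 * ∑ u, ∑ v, adjMat G u v * (h u * h v) := by
    simp only [Finset.mul_sum, ← Finset.sum_sub_distrib]
    exact Finset.sum_congr rfl fun u _ => Finset.sum_congr rfl fun v _ => by ring
  simp only [e]
  rw [Finset.sum_sub_distrib, ← Finset.sum_div, ← Finset.sum_div, sum_deg_mul_sq, e3]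
  ring

theorem adjMat_nonneg {V : Type*} [Fintype V] (G : SimpleGraph V) (u v : V) : 0 ≤ adjMat G u v := by
  simp only [adjMat, of_apply]
  split_ifs <;> norm_num

theorem vol_nonneg {V : Type*} [Fintype V] (G : SimpleGraph V) (S : Set V) : 0 ≤ vol G S :=
  Finset.sum_nonneg fun _ _ => Nat.cast_nonneg _

theorem vol_le_vol_univ {V : Type*} [Fintype V] (G : SimpleGraph V) (S : Set V) :
    vol G S ≤ vol G Set.univ :=
  Finset.sum_le_sum_of_subset_of_nonneg (fun v _ => by simp) fun _ _ _ => Nat.cast_nonneg _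

/-- The `±1` cut vector of `S`, cut off outside of `B`. -/
def cutVec (S B : Set V) : V → ℝ := fun v => if v ∈ B then (if v ∈ S then 1 else -1) else 0

theorem abs_cutVec_le {V : Type*} (S B : Set V) (v : V) : |cutVec S B v| ≤ 1 := by
  rw [cutVec]
  split_ifs <;> simp

theorem sum_adjMat_cutVec_sub_sq {V : Type*} [Fintype V] (G : SimpleGraph V) (S : Set V) :
    ∑ u, ∑ v, adjMat G u v * (cutVec S Set.univ u - cutVec S Set.univ v) ^ 2
      = 8 * eB G S Sᶜ := by
  have e2 : 8 * eB G S Sᶜ = 4 * eB G S Sᶜ + 4 * eB G Sᶜ S := by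
    rw [eB_comm G Sᶜ S]
    ring
  rw [e2, eB_eq_sum, eB_eq_sum]
  simp only [Finset.mul_sum, ← Finset.sum_add_distrib]
  refine Finset.sum_congr rfl fun u _ => Finset.sum_congr rfl fun v _ => ?_
  by_cases hu : u ∈ S <;> by_cases hv : v ∈ S <;> simp [cutVec, hu, hv] <;> ring

/-- The diagonal matrix `D^{1/2}`. -/
def degSqrt [Fintype V] [DecidableEq V] (G : SimpleGraph V) : Matrix V V ℝ :=
  Matrix.diagonal fun v => Real.sqrt (deg G v)

section Symmetrization

variable [Fintype V] [DecidableEq V] (G : SimpleGraph V)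

theorem isHermitian_half_normLap : (((1 : ℝ) / 2) • normLap G).IsHermitian := by
  ext u v
  by_cases h : u = v
  · simp [h]
  · simp [normLap, degInvSqrt, one_apply, h, Ne.symm h, adjMat_symm G u v]
    ring

theorem semiconjBy_degSqrt (hdeg : ∀ v, 1 ≤ deg G v) :
    SemiconjBy (degSqrt G) (walkM G) (((1 : ℝ) / 2) • normLap G) := by
  have h1 : degInvSqrt G * degSqrt G = 1 := by
    rw [degInvSqrt, degSqrt, diagonal_mul_diagonal, ← diagonal_one]
    congr 1
    ext v
    exact inv_mul_cancel₀ (Real.sqrt_pos.2 (by linarith [hdeg v])).ne'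
  have h2 : degSqrt G * degInv G = degInvSqrt G := by
    rw [degSqrt, degInv, degInvSqrt, diagonal_mul_diagonal]
    congr 1
    ext v
    have hd : 0 < deg G v := by linarith [hdeg v]
    have := Real.sqrt_pos.2 hd
    nth_rewrite 2 [← Real.sq_sqrt hd.le]
    field_simp
  rw [SemiconjBy, walkM, normLap, mul_smul_comm, smul_mul_assoc, mul_sub, sub_mul, one_mul, mul_one,
    mul_assoc _ _ (degSqrt G), h1, mul_one, ← mul_assoc, h2]

theorem degSqrt_mulVec_dotProduct (hdeg : ∀ v, 1 ≤ deg G v) (g h : V → ℝ) :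
    (degSqrt G *ᵥ g) ⬝ᵥ (degSqrt G *ᵥ h) = ∑ v, deg G v * g v * h v := by
  refine Finset.sum_congr rfl fun v _ => ?_
  rw [degSqrt, mulVec_diagonal, mulVec_diagonal]
  have := Real.mul_self_sqrt (show 0 ≤ deg G v by linarith [hdeg v])
  linear_combination g v * h v * this

theorem dotProduct_half_normLap_pow (hdeg : ∀ v, 1 ≤ deg G v) (h : V → ℝ) (t : ℕ) :
    (degSqrt G *ᵥ h) ⬝ᵥ ((((1 : ℝ) / 2) • normLap G) ^ t) *ᵥ (degSqrt G *ᵥ h)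
      = ∑ v, deg G v * h v * ((walkM G ^ t) *ᵥ h) v := by
  rw [mulVec_mulVec, ← ((semiconjBy_degSqrt G hdeg).pow_right t).eq, ← mulVec_mulVec,
    degSqrt_mulVec_dotProduct G hdeg]

theorem exists_degSqrt_mulVec (hdeg : ∀ v, 1 ≤ deg G v) (x : V → ℝ) :
    ∃ h, degSqrt G *ᵥ h = x := by
  refine ⟨fun v => x v / Real.sqrt (deg G v), ?_⟩
  ext v
  rw [degSqrt, mulVec_diagonal]
  exact mul_div_cancel₀ _ (Real.sqrt_pos.2 (by linarith [hdeg v])).ne'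

theorem dotProduct_half_normLap (hdeg : ∀ v, 1 ≤ deg G v) (h : V → ℝ) :
    (degSqrt G *ᵥ h) ⬝ᵥ (((1 : ℝ) / 2) • normLap G) *ᵥ (degSqrt G *ᵥ h)
      = (∑ u, ∑ v, adjMat G u v * (h u - h v) ^ 2) / 4 := by
  rw [← sum_deg_mul_walkM G hdeg]
  simpa only [pow_one] using dotProduct_half_normLap_pow G hdeg h 1

theorem half_normLap_nonneg (hdeg : ∀ v, 1 ≤ deg G v) (x : V → ℝ) :
    0 ≤ x ⬝ᵥ (((1 : ℝ) / 2) • normLap G) *ᵥ x := by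
  obtain ⟨h, rfl⟩ := exists_degSqrt_mulVec G hdeg x
  rw [dotProduct_half_normLap G hdeg]
  exact div_nonneg (Finset.sum_nonneg fun u _ => Finset.sum_nonneg fun v _ =>
    mul_nonneg (adjMat_nonneg G u v) (sq_nonneg _)) (by norm_num)

theorem half_normLap_le (hdeg : ∀ v, 1 ≤ deg G v) (x : V → ℝ) :
    x ⬝ᵥ (((1 : ℝ) / 2) • normLap G) *ᵥ x ≤ x ⬝ᵥ x := by
  obtain ⟨h, rfl⟩ := exists_degSqrt_mulVec G hdeg x
  have e : ∑ v, deg G v * h v * h v = ∑ v, deg G v * h v ^ 2 :=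
    Finset.sum_congr rfl fun v _ => by ring
  have hle : ∑ u, ∑ v, adjMat G u v * (h u - h v) ^ 2
      ≤ 2 * ∑ u, ∑ v, adjMat G u v * (h u ^ 2 + h v ^ 2) := by
    simp only [Finset.mul_sum]
    refine Finset.sum_le_sum fun u _ => Finset.sum_le_sum fun v _ => ?_
    have := mul_nonneg (adjMat_nonneg G u v) (sq_nonneg (h u + h v))
    linarith
  rw [dotProduct_half_normLap G hdeg, degSqrt_mulVec_dotProduct G hdeg, e, sum_deg_mul_sq]
  linarith

theorem sq_sum_abs_le (hdeg : ∀ v, 1 ≤ deg G v) (p : V → ℝ) :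
    (∑ u, |p u|) ^ 2 ≤ (∑ u, ((p ᵥ* degInvSqrt G) u) ^ 2) * vol G Set.univ := by
  have h := Finset.sum_mul_sq_le_sq_mul_sq Finset.univ
    (fun u => |p u| * (Real.sqrt (deg G u))⁻¹) (fun u => Real.sqrt (deg G u))
  have hd : ∀ u, 0 < deg G u := fun u => by linarith [hdeg u]
  have e1 : ∀ u, |p u| * (Real.sqrt (deg G u))⁻¹ * Real.sqrt (deg G u) = |p u| := fun u =>
    inv_mul_cancel_right₀ (Real.sqrt_pos.2 (hd u)).ne' _
  have e2 : ∀ u, Real.sqrt (deg G u) ^ 2 = deg G u := fun u => Real.sq_sqrt (hd u).le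
  simp only [e1, e2] at h
  simpa [degInvSqrt, vecMul_diagonal, vol, mul_pow] using h

/-- If `B` carries at least `7/8` of the volume, then the degree-weighted sum over `B` of the
`ℓ¹` norms of the walk vectors `1_v Mᵗ` is large. -/
theorem le_sum_deg_mul_sum_abs (hdeg : ∀ v, 1 ≤ deg G v) {ε : ℝ} (hε0 : 0 < ε) (hε1 : ε < 1 / 2)
    {S : Set V} (hS : (1 - ε) * eIn G Set.univ ≤ eB G S Sᶜ) {B : Set V}
    (hB : vol G Bᶜ ≤ vol G Set.univ / 8) (t : ℕ) :
    (1 - 2 * ε) ^ t * (vol G Set.univ / 8)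
      ≤ ∑ v with v ∈ B, deg G v * ∑ u, |(indVec v ᵥ* (walkM G ^ t)) u| := by
  have hnorm : (degSqrt G *ᵥ cutVec S Set.univ) ⬝ᵥ (degSqrt G *ᵥ cutVec S Set.univ)
      = vol G Set.univ := by
    rw [degSqrt_mulVec_dotProduct G hdeg]
    simp only [vol, Set.mem_univ, Finset.filter_true]
    refine Finset.sum_congr rfl fun v _ => ?_
    by_cases hv : v ∈ S <;> simp [cutVec, hv]
  have key := le_dotProduct_pow_mulVec (isHermitian_half_normLap G) (half_normLap_nonneg G hdeg)
    (half_normLap_le G hdeg) hε0 hε1 (x := degSqrt G *ᵥ cutVec S Set.univ)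
    (y := degSqrt G *ᵥ cutVec S B) (by
      rw [hnorm, dotProduct_half_normLap G hdeg, sum_adjMat_cutVec_sub_sq, ← eB_univ_univ]
      rw [eIn] at hS
      linarith) (by
      rw [hnorm, ← mulVec_sub, degSqrt_mulVec_dotProduct G hdeg]
      refine le_trans (le_of_eq ?_) hB
      rw [vol, Finset.sum_filter]
      refine Finset.sum_congr rfl fun v _ => ?_
      by_cases hv : v ∈ S <;> by_cases hb : v ∈ B <;> simp [cutVec, hv, hb]) t
  rw [hnorm, dotProduct_half_normLap_pow G hdeg] at key
  refine key.trans ?_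
  rw [Finset.sum_filter]
  refine Finset.sum_le_sum fun v _ => ?_
  by_cases hb : v ∈ B
  · have hd : 0 ≤ deg G v := by linarith [hdeg v]
    have hrow : ∀ u, (indVec v ᵥ* (walkM G ^ t)) u = (walkM G ^ t) v u := fun u => by
      simp [indVec, vecMul, dotProduct]
    have habs : |((walkM G ^ t) *ᵥ cutVec S B) v| ≤ ∑ u, |(walkM G ^ t) v u| := by
      refine (Finset.abs_sum_le_sum_abs _ _).trans (Finset.sum_le_sum fun u _ => ?_)
      rw [abs_mul]
      exact mul_le_of_le_one_right (abs_nonneg _) (abs_cutVec_le S B u)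
    simp only [hb, if_true, hrow]
    rw [mul_assoc]
    refine mul_le_mul_of_nonneg_left ?_ hd
    refine (le_abs_self _).trans ?_
    rw [abs_mul]
    exact (mul_le_of_le_one_left (abs_nonneg _) (abs_cutVec_le S B v)).trans habs
  · simp [cutVec, hb]

end Symmetrization

/-- If `G` has a cut `(S, Sᶜ)` of value at least `(1-ε)m` with
`0 < ε < 1/2`, then for every `t ≥ 0` there is a set `V_g` of volume at least
`μ_G/8` such that every `v ∈ V_g` satisfies
`Σ_u |(1_v M^t)(u)| ≥ (1/60)(1-2ε)^t`, and consequently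
`‖(1_v M^t) D^{-1/2}‖₂² ≥ (1/(3600 μ_G)) (1-2ε)^{2t}`. -/
theorem good_starting_vertices
    {V : Type*} [Fintype V] [DecidableEq V] (G : SimpleGraph V)
    (hdeg : ∀ v, 1 ≤ deg G v)
    (ε : ℝ) (hε0 : 0 < ε) (hε1 : ε < 1 / 2)
    (S : Set V) (hS : (1 - ε) * eIn G Set.univ ≤ eB G S Sᶜ)
    (t : ℕ) :
    ∃ Vg : Set V, vol G Set.univ / 8 ≤ vol G Vg ∧
      ∀ v ∈ Vg,
        (1 / 60) * (1 - 2 * ε) ^ t ≤ ∑ u, |(indVec v ᵥ* (walkM G ^ t)) u| ∧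
        (1 / (3600 * vol G Set.univ)) * (1 - 2 * ε) ^ (2 * t)
          ≤ ∑ u, ((indVec v ᵥ* (walkM G ^ t) ᵥ* degInvSqrt G) u) ^ 2 := by
  have hc : 0 < 1 - 2 * ε := by linarith
  refine ⟨{v | (1 / 60) * (1 - 2 * ε) ^ t ≤ ∑ u, |(indVec v ᵥ* (walkM G ^ t)) u|}, ?_, ?_⟩
  · by_contra! hlt
    set Vg := {v | (1 / 60) * (1 - 2 * ε) ^ t ≤ ∑ u, |(indVec v ᵥ* (walkM G ^ t)) u|}
    have hpos : 0 < vol G Set.univ := by linarith [vol_nonneg G Vg]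
    obtain ⟨B, hB⟩ : ∃ B, B = Vgᶜ := ⟨_, rfl⟩
    have h := le_sum_deg_mul_sum_abs G hdeg hε0 hε1 hS (B := B)
      (by rw [hB, compl_compl]; exact hlt.le) t
    have hup : ∑ v with v ∈ B, deg G v * ∑ u, |(indVec v ᵥ* (walkM G ^ t)) u|
        ≤ vol G B * ((1 / 60) * (1 - 2 * ε) ^ t) := by
      rw [vol, Finset.sum_mul]
      refine Finset.sum_le_sum fun v hv => mul_le_mul_of_nonneg_left ?_ ?_
      · have hv' : ¬ (1 / 60) * (1 - 2 * ε) ^ t ≤ ∑ u, |(indVec v ᵥ* (walkM G ^ t)) u| := by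
          have hvB : v ∈ B := (Finset.mem_filter.1 hv).2
          rw [hB] at hvB
          exact hvB
        exact (not_le.1 hv').le
      · linarith [hdeg v]
    have hct : 0 < (1 - 2 * ε) ^ t := pow_pos hc t
    have hmul := mul_le_mul_of_nonneg_right (vol_le_vol_univ G B) hct.le
    have := mul_pos hpos hct
    linarith
  · intro v hv
    have hv' : (1 / 60) * (1 - 2 * ε) ^ t ≤ ∑ u, |(indVec v ᵥ* (walkM G ^ t)) u| := hv
    refine ⟨hv', ?_⟩
    have hpos : 0 < vol G Set.univ := by
      refine Finset.sum_pos (fun u _ => by linarith [hdeg u]) ⟨v, by simp⟩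
    have h := (pow_le_pow_left₀ (by positivity) hv' 2).trans (sq_sum_abs_le G hdeg _)
    rw [← div_le_iff₀ hpos] at h
    refine le_trans (le_of_eq ?_) h
    field_simp
    ring

end Sublinear
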